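/- Let Γ = {Δ₁,…,Δ_N} be a non-singular semi-stable simplicial partition of an n-dimensional simplicial integral polytope Δ ⊂ ℝⁿ. Let p be a vertex of Γ lying in the relative interior of an l-dimensional face τ of Δ (with Δ itself counted as its own n-dimensional face, so τ = Δ and l = n is allowed), and let σ₀,…,σ_l be the l + 1 edges of the restricted partition Γ ∩ τ containing p. Then Σ_{i=0}^{l} σᵢ(p) = 0, where σᵢ(p) is the primitive vector of σᵢ at p. -/

import Mathlib

open Set

noncomputable section

/-- Cast an integer vector to a real vector. -/
def castVec {n : ℕ} (v : Fin n → ℤ) : Fin n → ℝ := fun i => (v i : ℝ)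

/-- Cast a rational vector to a real vector. -/
def castQVec {n : ℕ} (v : Fin n → ℚ) : Fin n → ℝ := fun i => (v i : ℝ)

/-- A rational polytope: the convex hull of finitely many rational points. -/
def IsRatPolytope {n : ℕ} (P : Set (Fin n → ℝ)) : Prop :=
  ∃ S : Finset (Fin n → ℚ), P = convexHull ℝ (castQVec '' (S : Set (Fin n → ℚ)))

/-- An integral polytope: the convex hull of finitely many lattice points. -/
def IsIntegralPolytope {n : ℕ} (P : Set (Fin n → ℝ)) : Prop :=
  ∃ S : Finset (Fin n → ℤ), P = convexHull ℝ (castVec '' (S : Set (Fin n → ℤ)))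

/-- The dimension of a set: the dimension of (the direction of) its affine span. -/
def polyDim {n : ℕ} (P : Set (Fin n → ℝ)) : ℕ :=
  Module.finrank ℝ (vectorSpan ℝ P)

/-- Faces of a polytope/polyhedron: intersections with supporting hyperplanes, together
with the set itself. -/
def IsFaceOf {n : ℕ} (F P : Set (Fin n → ℝ)) : Prop :=
  F = P ∨ ∃ (f : (Fin n → ℝ) →ₗ[ℝ] ℝ) (c : ℝ),
    (∀ x ∈ P, f x ≤ c) ∧ F = {x ∈ P | f x = c} ∧ F.Nonempty

/-- A vertex is a 0-dimensional (i.e. singleton) face. -/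
def IsVertexOf {n : ℕ} (p : Fin n → ℝ) (P : Set (Fin n → ℝ)) : Prop := IsFaceOf {p} P

/-- An edge is a 1-dimensional face. -/
def IsEdgeOf {n : ℕ} (e P : Set (Fin n → ℝ)) : Prop := IsFaceOf e P ∧ polyDim e = 1

/-- A `k`-dimensional polytope is simplicial if exactly `k` edges meet at each vertex. -/
def IsSimplicial {n : ℕ} (k : ℕ) (P : Set (Fin n → ℝ)) : Prop :=
  ∀ p, IsVertexOf p P → {e | IsEdgeOf e P ∧ p ∈ e}.ncard = k

/-- A simplicial partition of a `k`-dimensional simplicial rational polytope `Δ ⊆ ℝⁿ`: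
finitely many `k`-dimensional simplicial rational polytopes whose union is `Δ` and
such that the intersection of any two of them is a (possibly empty) common face. -/
structure SimplicialPartition (n k N : ℕ) (Δ : Set (Fin n → ℝ)) : Type where
  pieces : Fin N → Set (Fin n → ℝ)
  piece_rat : ∀ j, IsRatPolytope (pieces j)
  piece_dim : ∀ j, polyDim (pieces j) = k
  piece_simplicial : ∀ j, IsSimplicial k (pieces j)
  covers : ⋃ j, pieces j = Δ
  common_face : ∀ i j, i ≠ j → pieces i ∩ pieces j = ∅ ∨
    (IsFaceOf (pieces i ∩ pieces j) (pieces i) ∧ IsFaceOf (pieces i ∩ pieces j) (pieces j))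

variable {n k N : ℕ} {Δ : Set (Fin n → ℝ)}

/-- A face of the partition `Γ`: a face of one of the subpolytopes, where the
vertices of `Δ` are excluded as 0-faces. -/
def IsGammaFace (Γ : SimplicialPartition n k N Δ) (σ : Set (Fin n → ℝ)) : Prop :=
  (∃ j, IsFaceOf σ (Γ.pieces j)) ∧ ∀ v : Fin n → ℝ, σ = {v} → ¬ IsVertexOf v Δ

/-- A vertex of the partition `Γ`: a vertex of some subpolytope which is not a vertex of `Δ`. -/
def IsGammaVertex (Γ : SimplicialPartition n k N Δ) (p : Fin n → ℝ) : Prop :=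
  (∃ j, IsVertexOf p (Γ.pieces j)) ∧ ¬ IsVertexOf p Δ

/-- An edge of the partition `Γ`. -/
def IsGammaEdge (Γ : SimplicialPartition n k N Δ) (e : Set (Fin n → ℝ)) : Prop :=
  (∃ j, IsFaceOf e (Γ.pieces j)) ∧ polyDim e = 1

/-- `Γ` is semi-stable: for each face `σ` of `Γ`, if `τ` is the smallest face of `Δ`
containing `σ`, then exactly `dim τ − dim σ + 1` of the subpolytopes have `σ` as a face. -/
def IsSemiStable (Γ : SimplicialPartition n k N Δ) : Prop :=
  ∀ σ, IsGammaFace Γ σ →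
    ∀ τ, IsFaceOf τ Δ → σ ⊆ τ → (∀ τ', IsFaceOf τ' Δ → σ ⊆ τ' → τ ⊆ τ') →
      {j | IsFaceOf σ (Γ.pieces j)}.ncard = polyDim τ - polyDim σ + 1

/-- `v` is the primitive vector of the edge `σ` at its vertex `p`: the shortest nonzero
lattice vector on the ray from `p` along `σ`. -/
def IsPrimitiveEdgeVector {n : ℕ} (σ : Set (Fin n → ℝ)) (p : Fin n → ℝ) (v : Fin n → ℤ) : Prop :=
  v ≠ 0 ∧ (∃ t : ℝ, 0 < t ∧ p + t • castVec v ∈ σ) ∧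
    ∀ w : Fin n → ℤ, w ≠ 0 → (∃ s : ℝ, 0 < s ∧ castVec w = s • castVec v) →
      ∃ m : ℕ, 1 ≤ m ∧ w = (m : ℤ) • v

/-- A vertex `p` of a full-dimensional simplicial integral polytope `P ⊆ ℝⁿ` is non-singular
if the primitive vectors of the `n` edges of `P` at `p` form a `ℤ`-basis of `ℤⁿ`. -/
def IsNonsingularVertexOf {n : ℕ} (p : Fin n → ℝ) (P : Set (Fin n → ℝ)) : Prop :=
  IsVertexOf p P ∧
  ∃ (e : Fin n → Set (Fin n → ℝ)) (v : Fin n → Fin n → ℤ),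
    Function.Injective e ∧
    (∀ i, IsEdgeOf (e i) P ∧ p ∈ e i ∧ IsPrimitiveEdgeVector (e i) p (v i)) ∧
    (∀ e', IsEdgeOf e' P → p ∈ e' → ∃ i, e' = e i) ∧
    Submodule.span ℤ (Set.range v) = ⊤

/-- A non-singular polytope: integral, simplicial, and all vertices non-singular. -/
def IsNonsingularPolytope {n : ℕ} (k : ℕ) (P : Set (Fin n → ℝ)) : Prop :=
  IsIntegralPolytope P ∧ IsSimplicial k P ∧ ∀ p, IsVertexOf p P → IsNonsingularVertexOf p P

/-- A non-singular partition: `Δ` and all the subpolytopes are integral, and every vertex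
of `Γ` is a non-singular vertex of every subpolytope containing it. -/
def IsNonsingularPartition (Γ : SimplicialPartition n k N Δ) : Prop :=
  IsIntegralPolytope Δ ∧ (∀ j, IsIntegralPolytope (Γ.pieces j)) ∧
    ∀ p, IsGammaVertex Γ p → ∀ j, p ∈ Γ.pieces j → IsNonsingularVertexOf p (Γ.pieces j)

/-- An edge of the restricted partition `Γ ∩ τ`. -/
def IsRestrictedEdge (Γ : SimplicialPartition n k N Δ) (τ σ : Set (Fin n → ℝ)) : Prop :=
  ∃ j, IsFaceOf σ (Γ.pieces j ∩ τ) ∧ polyDim σ = 1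

/-- A maximal vertex of `Γ`: a vertex of `Γ` lying in the relative interior of a face of `Δ`
of the largest possible dimension among faces of `Δ` containing vertices of `Γ` in their
relative interiors. -/
def IsMaximalVertex (Γ : SimplicialPartition n k N Δ) (p : Fin n → ℝ) : Prop :=
  IsGammaVertex Γ p ∧ ∃ τ, IsFaceOf τ Δ ∧ p ∈ intrinsicInterior ℝ τ ∧
    ∀ (q : Fin n → ℝ) (τ' : Set (Fin n → ℝ)), IsGammaVertex Γ q → IsFaceOf τ' Δ →
      q ∈ intrinsicInterior ℝ τ' → polyDim τ' ≤ polyDim τ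

/-- `Γ` is balanced: at each vertex `p` of `Γ`, lying in the relative interior of an
`l`-dimensional face `τ` of `Δ`, any relation `∑ wᵢ σᵢ(p) = 0` with positive weights of
gcd 1 among the primitive vectors of the `l+1` edges of `Γ ∩ τ` at `p` has all weights 1. -/
def IsBalanced (Γ : SimplicialPartition n k N Δ) : Prop :=
  ∀ p, IsGammaVertex Γ p → ∀ (l : ℕ) (τ : Set (Fin n → ℝ)),
    IsFaceOf τ Δ → polyDim τ = l → p ∈ intrinsicInterior ℝ τ →
    ∀ (σ : Fin (l+1) → Set (Fin n → ℝ)) (v : Fin (l+1) → Fin n → ℤ) (w : Fin (l+1) → ℤ),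
      Function.Injective σ →
      (∀ i, IsRestrictedEdge Γ τ (σ i) ∧ p ∈ σ i ∧ IsPrimitiveEdgeVector (σ i) p (v i)) →
      (∀ e, IsRestrictedEdge Γ τ e → p ∈ e → ∃ i, e = σ i) →
      (∀ i, 0 < w i) → Finset.univ.gcd w = 1 → (∑ i, w i • v i) = 0 →
      ∀ i, w i = 1

/-- `Γ` is mildly singular: balanced seim-stable and all maximal vertices are non-singular. -/
def IsMildlySingular (Γ : SimplicialPartition n k N Δ) : Prop :=
  IsBalanced Γ ∧
    ∀ p, IsMaximalVertex Γ p → ∀ j, p ∈ Γ.pieces j → IsNonsingularVertexOf p (Γ.pieces j)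

/-- An affine function with rational coefficients. -/
def IsRatAffine {n : ℕ} (f : (Fin n → ℝ) →ᵃ[ℝ] ℝ) : Prop :=
  ∃ (a : Fin n → ℚ) (b : ℚ), ∀ x : Fin n → ℝ, f x = (∑ i, (a i : ℝ) * x i) + (b : ℝ)

/-- `f = f_{ij,p}`: the affine function vanishing on the hyperplane containing the
`(n−1)`-face `Δᵢ ∩ Δⱼ` of `Γ` and taking value 1 at `p + τ₀(p)`, where `τ₀` is the
(unique) edge of `Γ` at `p` not contained in `Δᵢ`. -/
def IsNormalizedAffine (Γ : SimplicialPartition n k N Δ) (i j : Fin N) (p : Fin n → ℝ)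
    (f : (Fin n → ℝ) →ᵃ[ℝ] ℝ) : Prop :=
  (∀ x, x ∈ affineSpan ℝ (Γ.pieces i ∩ Γ.pieces j) → f x = 0) ∧
  ∃ (τ₀ : Set (Fin n → ℝ)) (v : Fin n → ℤ),
    IsGammaEdge Γ τ₀ ∧ p ∈ τ₀ ∧ ¬ τ₀ ⊆ Γ.pieces i ∧
    IsPrimitiveEdgeVector τ₀ p v ∧ f (p + castVec v) = 1

/-- The data entering the concavity `C(f,p)` of a piecewise affine function at a vertex `p`
of `Γ`: the face `τ` of `Δ` with `p` in its relative interior, the `l+1` edges `σᵢ` of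
`Γ ∩ τ` at `p`, their primitive vectors `vᵢ` and subpolytopes `Δ_{jsᵢ}` having `σᵢ` as
an edge. -/
def ConcavityDatum (Γ : SimplicialPartition n k N Δ) (p : Fin n → ℝ) (l : ℕ)
    (τ : Set (Fin n → ℝ)) (σ : Fin (l+1) → Set (Fin n → ℝ))
    (v : Fin (l+1) → Fin n → ℤ) (js : Fin (l+1) → Fin N) : Prop :=
  IsFaceOf τ Δ ∧ polyDim τ = l ∧ p ∈ intrinsicInterior ℝ τ ∧
  Function.Injective σ ∧
  (∀ i, IsFaceOf (σ i) (Γ.pieces (js i) ∩ τ) ∧ polyDim (σ i) = 1 ∧ p ∈ σ i ∧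
    IsPrimitiveEdgeVector (σ i) p (v i)) ∧
  (∀ e, IsRestrictedEdge Γ τ e → p ∈ e → ∃ i, e = σ i)

/-- The concavity `C(f,p) = ∑ᵢ (fᵢ(p + σᵢ(p)) − fᵢ(p))` of the piecewise affine function
with affine pieces `g j` at the vertex `p`, for given concavity data. -/
def concavitySum (Γ : SimplicialPartition n k N Δ) (g : Fin N → ((Fin n → ℝ) →ᵃ[ℝ] ℝ))
    (p : Fin n → ℝ) {l : ℕ} (v : Fin (l+1) → Fin n → ℤ) (js : Fin (l+1) → Fin N) : ℝ :=
  ∑ i, (g (js i) (p + castVec (v i)) - g (js i) p)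

/-- Projection ℝ^{n+1} → ℝⁿ forgetting the 0-th (extra) coordinate. -/
def projDown {n : ℕ} (z : Fin (n+1) → ℝ) : Fin n → ℝ := fun i => z i.succ

/-- The lifted polyhedron `Δ̃ = {(y,x) ∈ ℝ × Δ : y ≥ F(x)}`. -/
def liftSet {n : ℕ} (Δ : Set (Fin n → ℝ)) (F : (Fin n → ℝ) → ℝ) : Set (Fin (n+1) → ℝ) :=
  {z | projDown z ∈ Δ ∧ F (projDown z) ≤ z 0}

/-- A polyhedron: a finite intersection of closed half-spaces. -/
def IsPolyhedron {m : ℕ} (P : Set (Fin m → ℝ)) : Prop :=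
  ∃ (s : ℕ) (a : Fin s → ((Fin m → ℝ) →ₗ[ℝ] ℝ)) (c : Fin s → ℝ),
    P = {x | ∀ i, a i x ≤ c i}

/-- `castVec` as a `ℤ`-linear map. -/
def castVecHom (n : ℕ) : (Fin n → ℤ) →ₗ[ℤ] (Fin n → ℝ) where
  toFun := castVec
  map_add' x y := by ext; simp [castVec]
  map_smul' m x := by ext; simp [castVec]

theorem castVec_injective {n : ℕ} : Function.Injective (castVec (n := n)) := fun x y h => by
  ext i
  simpa [castVec] using congrFun h i

theorem castVec_ne_zero {n : ℕ} {x : Fin n → ℤ} (hx : x ≠ 0) : castVec x ≠ 0 := fun h =>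
  hx (castVec_injective (h.trans (castVecHom n).map_zero.symm))

theorem castVec_sum_smul {n : ℕ} {ι : Type*} [Fintype ι] (m : ι → ℤ) (b : ι → Fin n → ℤ) :
    castVec (∑ a, m a • b a) = ∑ a, (m a : ℝ) • castVec (b a) := by
  have h := map_sum (castVecHom n) (fun a => m a • b a) Finset.univ
  simp only [map_smul] at h
  simp only [Int.cast_smul_eq_zsmul]
  exact h

theorem linearIndependent_castVec {n : ℕ} {b : Fin n → Fin n → ℤ}
    (hb : Submodule.span ℤ (Set.range b) = ⊤) :
    LinearIndependent ℝ (fun a => castVec (b a)) := by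
  apply linearIndependent_of_top_le_span_of_card_eq_finrank _ (by simp)
  rw [← (Pi.basisFun ℝ (Fin n)).span_eq, Submodule.span_le]
  rintro _ ⟨i, rfl⟩
  have hi : (Pi.single i 1 : Fin n → ℤ) ∈ Submodule.span ℤ (Set.range b) := hb ▸ trivial
  obtain ⟨m, hm⟩ := (Submodule.mem_span_range_iff_exists_fun ℤ).1 hi
  have hcast : Pi.basisFun ℝ (Fin n) i = castVec (∑ a, m a • b a) := by
    rw [hm]
    ext k
    simp [castVec, Pi.single_apply]
  rw [hcast, castVec_sum_smul]
  exact Submodule.sum_mem _ fun a _ =>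
    Submodule.smul_mem _ _ (Submodule.subset_span ⟨a, rfl⟩)

theorem IsFaceOf.subset {n : ℕ} {F P : Set (Fin n → ℝ)} (h : IsFaceOf F P) : F ⊆ P := by
  rcases h with rfl | ⟨f, c, -, rfl, -⟩
  · rfl
  · exact fun x hx => hx.1

/-- At a vertex of `P` distinct from `P` itself, some functional is strictly maximal. -/
theorem IsVertexOf.exists_pos {n : ℕ} {p : Fin n → ℝ} {P : Set (Fin n → ℝ)}
    (h : IsVertexOf p P) :
    ∃ f : (Fin n → ℝ) →ₗ[ℝ] ℝ, ∀ x ∈ P, x ≠ p → 0 < f (x - p) := by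
  rcases h with h | ⟨f, c, hle, heq, -⟩
  · refine ⟨0, fun x hx hxp => absurd ?_ hxp⟩
    rw [← h] at hx
    exact hx
  · refine ⟨-f, fun x hx hxp => ?_⟩
    have hp : p ∈ {x ∈ P | f x = c} := heq ▸ rfl
    have hne : f x ≠ c := fun hc => hxp (by
      have : x ∈ ({p} : Set (Fin n → ℝ)) := heq ▸ ⟨hx, hc⟩
      exact this)
    have := lt_of_le_of_ne (hle x hx) hne
    simp [hp.2, this]

/-- A polytope lies in the cone spanned by its edges at any of its vertices. -/
theorem sub_mem_span_edges {n : ℕ} {S P : Set (Fin n → ℝ)} (hS : S.Finite)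
    (hP : P = convexHull ℝ S) {p : Fin n → ℝ} (hp : IsVertexOf p P)
    {y : Fin n → ℝ} (hy : y ∈ P) :
    y - p ∈ Submodule.span NNReal {g | ∃ e, IsEdgeOf e P ∧ p ∈ e ∧ p + g ∈ e} := by
  set K := Submodule.span NNReal {g | ∃ e, IsEdgeOf e P ∧ p ∈ e ∧ p + g ∈ e} with hK
  have hpP : p ∈ P := IsFaceOf.subset hp rfl
  obtain ⟨h, hpos⟩ := hp.exists_pos
  have hSP : S ⊆ P := hP ▸ subset_convexHull ℝ S
  have hsmul : ∀ r : ℝ, 0 ≤ r → ∀ x ∈ K, r • x ∈ K := fun r hr x hx =>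
    K.smul_mem (⟨r, hr⟩ : NNReal) hx
  have hKconv : Convex ℝ (K : Set (Fin n → ℝ)) := fun x hx y hy a b ha hb _ =>
    K.add_mem (hsmul a ha x hx) (hsmul b hb y hy)
  set G : Set (Fin n → ℝ) := (fun s => (h (s - p))⁻¹ • (s - p)) '' (S \ {p}) with hG
  have hGfin : G.Finite := (hS.sdiff).image _
  have hGh : ∀ g ∈ G, h g = 1 := by
    rintro _ ⟨s, ⟨hs, hsp⟩, rfl⟩
    simp only [map_smul, smul_eq_mul]
    exact inv_mul_cancel₀ (hpos s (hSP hs) hsp).ne'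
  have hext : ∀ g ∈ (convexHull ℝ G).extremePoints ℝ, g ∈ K := by
    intro g hg
    have hgG : g ∈ G := extremePoints_convexHull_subset hg
    have hg1 := hGh g hgG
    have hnot : g ∉ convexHull ℝ (G \ {g}) := fun hmem =>
      (((convex_convexHull ℝ G).mem_extremePoints_iff_mem_sdiff_convexHull_sdiff).1 hg).2
        (convexHull_mono (sdiff_subset_sdiff_left (subset_convexHull ℝ G)) hmem)
    obtain ⟨φ, u, hφ, hφg⟩ := geometric_hahn_banach_closed_point (convex_convexHull ℝ (G \ {g}))
      (hGfin.sdiff.isCompact_convexHull ℝ).isClosed hnot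
    set f : (Fin n → ℝ) →ₗ[ℝ] ℝ := (φ : (Fin n → ℝ) →ₗ[ℝ] ℝ) - φ g • h with hf
    have hfapply : ∀ x, f x = φ x - φ g * h x := fun x => by simp [hf]
    have hfg : ∀ x ∈ G, x ≠ g → f x < 0 := fun x hx hxg => by
      have := hφ x (subset_convexHull ℝ _ ⟨hx, hxg⟩)
      rw [hfapply, hGh x hx]
      linarith
    -- the locus of points of `P` on the ray from `p` along `g`
    have key : ∀ x ∈ P, f (x - p) ≤ 0 ∧ (f (x - p) = 0 → ∃ r : ℝ, x - p = r • g) := by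
      have hconv : Convex ℝ {x | f (x - p) ≤ 0 ∧ (f (x - p) = 0 → ∃ r : ℝ, x - p = r • g)} := by
        intro x hx y hy a b ha hb hab
        have hsplit : a • x + b • y - p = a • (x - p) + b • (y - p) := by
          rw [smul_sub, smul_sub]
          have : p = a • p + b • p := by rw [← add_smul, hab, one_smul]
          nth_rewrite 1 [this]
          abel
        have h1 := mul_nonpos_of_nonneg_of_nonpos ha hx.1
        have h2 := mul_nonpos_of_nonneg_of_nonpos hb hy.1
        simp only [mem_ofPred_eq, hsplit, map_add, map_smul, smul_eq_mul]
        refine ⟨by linarith, fun h0 => ?_⟩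
        have h1' : a * f (x - p) = 0 := by linarith
        have h2' : b * f (y - p) = 0 := by linarith
        have hx' : ∃ r : ℝ, a • (x - p) = r • g := by
          rcases mul_eq_zero.1 h1' with h | h
          · exact ⟨0, by simp [h]⟩
          · obtain ⟨r, hr⟩ := hx.2 h
            exact ⟨a * r, by rw [hr, smul_smul]⟩
        have hy' : ∃ r : ℝ, b • (y - p) = r • g := by
          rcases mul_eq_zero.1 h2' with h | h
          · exact ⟨0, by simp [h]⟩
          · obtain ⟨r, hr⟩ := hy.2 h
            exact ⟨b * r, by rw [hr, smul_smul]⟩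
        obtain ⟨r, hr⟩ := hx'
        obtain ⟨r', hr'⟩ := hy'
        exact ⟨r + r', by rw [hr, hr', add_smul]⟩
      rw [hP]
      refine fun x hx => convexHull_min (fun s hs => ?_) hconv hx
      by_cases hsp : s = p
      · subst hsp
        exact ⟨by simp, fun _ => ⟨0, by simp⟩⟩
      have hps := hpos s (hSP hs) hsp
      have hsG : (h (s - p))⁻¹ • (s - p) ∈ G := ⟨s, ⟨hs, hsp⟩, rfl⟩
      have hs_eq : s - p = h (s - p) • ((h (s - p))⁻¹ • (s - p)) := by
        rw [smul_smul, mul_inv_cancel₀ hps.ne', one_smul]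
      by_cases hsg : (h (s - p))⁻¹ • (s - p) = g
      · rw [hsg] at hs_eq
        refine ⟨?_, fun _ => ⟨_, hs_eq⟩⟩
        rw [hs_eq, map_smul, hfapply, hg1]
        simp
      · have hlt := hfg _ hsG hsg
        have : f (s - p) < 0 := by
          rw [hs_eq, map_smul, smul_eq_mul]
          exact mul_neg_of_pos_of_neg hps hlt
        exact ⟨this.le, fun h0 => absurd h0 this.ne⟩
    obtain ⟨s, ⟨hs, hsp⟩, hsg⟩ := hgG
    have hps := hpos s (hSP hs) hsp
    have hs_eq : s - p = h (s - p) • g := by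
      rw [← hsg]
      simp only [smul_smul]
      rw [mul_inv_cancel₀ hps.ne', one_smul]
    have hfs : f (s - p) = 0 := by
      rw [hs_eq, map_smul, hfapply, hg1]
      simp
    have hg0 : g ≠ 0 := fun h0 => by simp [h0] at hg1
    have hpe : p ∈ {x ∈ P | f x = f p} := ⟨hpP, rfl⟩
    have hse : s ∈ {x ∈ P | f x = f p} := ⟨hSP hs, by
      rw [map_sub] at hfs
      linarith⟩
    have hedge : IsEdgeOf {x ∈ P | f x = f p} P := by
      refine ⟨Or.inr ⟨f, f p, fun x hx => ?_, rfl, p, hpe⟩, ?_⟩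
      · have := (key x hx).1
        rw [map_sub] at this
        linarith
      · have hspan : vectorSpan ℝ {x ∈ P | f x = f p} = Submodule.span ℝ {g} := by
          apply le_antisymm
          · rw [vectorSpan_eq_span_vsub_set_right ℝ hpe, Submodule.span_le]
            rintro _ ⟨x, ⟨hx, hfx⟩, rfl⟩
            obtain ⟨r, hr⟩ := (key x hx).2 (by rw [map_sub, hfx, sub_self])
            exact Submodule.mem_span_singleton.2 ⟨r, hr.symm⟩
          · rw [Submodule.span_singleton_le_iff_mem, ← hsg]
            exact Submodule.smul_mem _ _ (vsub_mem_vectorSpan ℝ hse hpe)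
        rw [polyDim, hspan, finrank_span_singleton hg0]
    rw [← hsg]
    refine hsmul _ (inv_nonneg.2 hps.le) _ (Submodule.subset_span ⟨_, hedge, hpe, ?_⟩)
    rwa [add_sub_cancel]
  have hGK : convexHull ℝ G ⊆ K := by
    have hcomp := hGfin.isCompact_convexHull ℝ
    have hKM := closure_convexHull_extremePoints hcomp (convex_convexHull ℝ G)
    have hfin : ((convexHull ℝ G).extremePoints ℝ).Finite :=
      hGfin.subset extremePoints_convexHull_subset
    rw [(hfin.isCompact_convexHull ℝ).isClosed.closure_eq] at hKM
    rw [← hKM]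
    exact convexHull_min hext hKconv
  have hsub : P ⊆ {x | x - p ∈ K} := by
    rw [hP]
    refine convexHull_min (fun s hs => ?_) ?_
    · by_cases hsp : s = p
      · simp [hsp]
      have hps := hpos s (hSP hs) hsp
      have hsG : (h (s - p))⁻¹ • (s - p) ∈ G := ⟨s, ⟨hs, hsp⟩, rfl⟩
      have := hsmul _ hps.le _ (hGK (subset_convexHull ℝ _ hsG))
      rwa [smul_smul, mul_inv_cancel₀ hps.ne', one_smul] at this
    · have := hKconv.translate_preimage_left (-p)
      simpa [preimage, sub_eq_add_neg] using this
  exact hsub hy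

/-- All points of an edge at a vertex `p` lie on one ray from `p`. -/
theorem IsVertexOf.exists_smul_of_edge {n : ℕ} {p b g : Fin n → ℝ} {e P : Set (Fin n → ℝ)}
    (hp : IsVertexOf p P) (heP : e ⊆ P) (he : polyDim e = 1) (hpe : p ∈ e) (hb : b ≠ 0)
    {t : ℝ} (ht : 0 < t) (hte : p + t • b ∈ e) (hge : p + g ∈ e) :
    ∃ r : ℝ, 0 ≤ r ∧ g = r • b := by
  obtain ⟨h, hpos⟩ := hp.exists_pos
  have htb : t • b ≠ 0 := smul_ne_zero ht.ne' hb
  have h1 : t • b ∈ vectorSpan ℝ e := by simpa using vsub_mem_vectorSpan ℝ hte hpe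
  have h2 : g ∈ vectorSpan ℝ e := by simpa using vsub_mem_vectorSpan ℝ hge hpe
  obtain ⟨r, hr⟩ := exists_smul_eq_of_finrank_eq_one he
    (x := (⟨t • b, h1⟩ : vectorSpan ℝ e)) (by simpa using htb) ⟨g, h2⟩
  have hr' : g = r • t • b := (congrArg Subtype.val hr).symm
  refine ⟨r * t, mul_nonneg ?_ ht.le, by rw [hr', smul_smul]⟩
  have hb1 : 0 < h (t • b) := by
    simpa using hpos _ (heP hte) (by simpa using htb)
  by_cases hg : g = 0
  · rw [hg, eq_comm, smul_eq_zero] at hr'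
    exact (hr'.resolve_right htb).ge
  · have hg1 : 0 < h g := by simpa using hpos _ (heP hge) (by simpa using hg)
    rw [hr', map_smul, smul_eq_mul] at hg1
    exact (pos_of_mul_pos_left hg1 hb1.le).le

/-- An edge has at most one primitive vector at a vertex. -/
theorem IsPrimitiveEdgeVector.unique {n : ℕ} {p : Fin n → ℝ} {e P : Set (Fin n → ℝ)}
    (hp : IsVertexOf p P) (heP : e ⊆ P) (he : polyDim e = 1) (hpe : p ∈ e)
    {b b' : Fin n → ℤ} (hb : IsPrimitiveEdgeVector e p b) (hb' : IsPrimitiveEdgeVector e p b') :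
    b = b' := by
  have hray : ∀ x y : Fin n → ℤ, IsPrimitiveEdgeVector e p x → IsPrimitiveEdgeVector e p y →
      ∃ m : ℕ, 1 ≤ m ∧ y = (m : ℤ) • x := by
    rintro x y ⟨hx, ⟨t, ht, hte⟩, hxm⟩ ⟨hy, ⟨s, hs, hse⟩, -⟩
    have hx0 := castVec_ne_zero hx
    have hy0 := castVec_ne_zero hy
    obtain ⟨r, hr, hreq⟩ := hp.exists_smul_of_edge heP he hpe hx0 ht hte hse
    have hr0 : 0 < r := lt_of_le_of_ne hr fun h => by
      rw [← h, zero_smul] at hreq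
      exact smul_ne_zero hs.ne' hy0 hreq
    refine hxm y hy ⟨s⁻¹ * r, by positivity, ?_⟩
    rw [mul_smul, ← hreq, smul_smul, inv_mul_cancel₀ hs.ne', one_smul]
  obtain ⟨m, hm, h1⟩ := hray b b' hb hb'
  obtain ⟨m', hm', h2⟩ := hray b' b hb' hb
  have hmm : ((1 : ℤ) - m' * m) • b = 0 := by
    rw [sub_smul, one_smul, mul_smul, ← h1, ← h2, sub_self]
  have : (1 : ℤ) - m' * m = 0 := (smul_eq_zero.1 hmm).resolve_right hb.1
  have hm1 : m = 1 := Nat.eq_one_of_mul_eq_one_left (m := m') (by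
    have : ((m' * m : ℕ) : ℤ) = 1 := by push_cast; linarith
    exact_mod_cast this)
  rw [h1, hm1]
  simp

/-- From a relative interior point one can move a little in any direction of the affine span. -/
theorem eventually_add_smul_mem_of_mem_intrinsicInterior {n : ℕ} {τ : Set (Fin n → ℝ)}
    {p u : Fin n → ℝ} (hp : p ∈ intrinsicInterior ℝ τ) (hu : u ∈ vectorSpan ℝ τ) :
    ∀ᶠ ε in nhds (0 : ℝ), p + ε • u ∈ τ := by
  obtain ⟨q, hq, rfl⟩ := hp
  have hmem : ∀ ε : ℝ, (q : Fin n → ℝ) + ε • u ∈ affineSpan ℝ τ := fun ε => by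
    have := AffineSubspace.vadd_mem_of_mem_direction
      (s := affineSpan ℝ τ) (v := ε • u) (by
        rw [direction_affineSpan]
        exact Submodule.smul_mem _ _ hu) q.2
    rwa [vadd_eq_add, add_comm] at this
  have hcont : Continuous fun ε : ℝ => (⟨(q : Fin n → ℝ) + ε • u, hmem ε⟩ : affineSpan ℝ τ) :=
    Continuous.subtype_mk (by fun_prop) _
  have h0 : (⟨(q : Fin n → ℝ) + (0 : ℝ) • u, hmem 0⟩ : affineSpan ℝ τ) = q :=
    Subtype.ext (by simp)
  have := hcont.continuousAt (x := 0) |>.preimage_mem_nhds (t := interior ((↑) ⁻¹' τ))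
    (by rw [h0]; exact isOpen_interior.mem_nhds hq)
  filter_upwards [this] with ε hε
  exact interior_subset (s := ((↑) ⁻¹' τ : Set (affineSpan ℝ τ))) hε

/-- If `l + 1` integer vectors span a real space of dimension at least `l`, and each of them occurs
with coefficient one in a linear relation with natural coefficients, then they sum to zero. -/
theorem sum_eq_zero_of_neg_combinations {n l : ℕ} {v : Fin (l + 1) → Fin n → ℤ}
    (hspan : l ≤ Module.finrank ℝ (Submodule.span ℝ (Set.range fun i => castVec (v i))))
    (hrel : ∀ i, ∃ c : Fin (l + 1) → ℤ, (∀ k, 0 ≤ c k) ∧ c i = 1 ∧ ∑ k, c k • v k = 0) :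
    ∑ i, v i = 0 := by
  choose c hc0 hc1 hc using hrel
  set Φ : (Fin (l + 1) → ℝ) →ₗ[ℝ] (Fin n → ℝ) :=
    Fintype.linearCombination ℝ (fun i => castVec (v i)) with hΦ
  have hker : Module.finrank ℝ (LinearMap.ker Φ) ≤ 1 := by
    have h1 := Φ.finrank_range_add_finrank_ker
    rw [Module.finrank_fin_fun, hΦ, Fintype.range_linearCombination, ← hΦ] at h1
    omega
  have hmem : ∀ i, (fun k => (c i k : ℝ)) ∈ LinearMap.ker Φ := fun i => by
    rw [LinearMap.mem_ker, hΦ, Fintype.linearCombination_apply, ← castVec_sum_smul, hc]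
    exact (castVecHom n).map_zero
  have hcoef : ∀ i k, c i k = 1 := by
    intro i k
    obtain ⟨w, hw⟩ := finrank_le_one_iff.1 hker
    obtain ⟨a, ha⟩ := hw ⟨_, hmem i⟩
    obtain ⟨b, hb⟩ := hw ⟨_, hmem k⟩
    have ha' : ∀ q, a * w.1 q = c i q := fun q => congrFun (congrArg Subtype.val ha) q
    have hb' : ∀ q, b * w.1 q = c k q := fun q => congrFun (congrArg Subtype.val hb) q
    have hprod : (c i k : ℝ) * c k i = c i i * c k k := by
      rw [← ha', ← ha', ← hb', ← hb']
      ring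
    have hprod' : c i k * c k i = 1 := by
      rw [hc1, hc1] at hprod
      exact_mod_cast hprod
    rcases Int.eq_one_or_neg_one_of_mul_eq_one hprod' with h | h
    · exact h
    · have := hc0 i k
      omega
  simpa [hcoef 0] using hc 0

/-- Every direction of `τ` at `p` is a nonnegative combination of the edge vectors at `p` of a
single piece, and the ones occurring belong to edges lying in `τ`. -/
theorem exists_nonneg_combination {n N : ℕ} {Δ : Set (Fin n → ℝ)}
    (Γ : SimplicialPartition n n N Δ) (hns : IsNonsingularPartition Γ)
    {p : Fin n → ℝ} (hp : IsGammaVertex Γ p) {τ : Set (Fin n → ℝ)} (hτ : IsFaceOf τ Δ)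
    (hpin : p ∈ intrinsicInterior ℝ τ) {u : Fin n → ℝ} (hu : u ∈ vectorSpan ℝ τ) :
    ∃ (j : Fin N) (e : Fin n → Set (Fin n → ℝ)) (b : Fin n → Fin n → ℤ) (c : Fin n → ℝ),
      IsVertexOf p (Γ.pieces j) ∧
      (∀ a, IsEdgeOf (e a) (Γ.pieces j) ∧ p ∈ e a ∧ IsPrimitiveEdgeVector (e a) p (b a)) ∧
      Submodule.span ℤ (Set.range b) = ⊤ ∧ (∀ a, 0 ≤ c a) ∧
      u = ∑ a, c a • castVec (b a) ∧
      ∀ a, c a ≠ 0 → IsRestrictedEdge Γ τ (e a) := by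
  have hpτ : p ∈ τ := intrinsicInterior_subset hpin
  have hfin : ∀ j, ∃ S : Set (Fin n → ℝ), S.Finite ∧ Γ.pieces j = convexHull ℝ S := fun j => by
    obtain ⟨S, hS⟩ := Γ.piece_rat j
    exact ⟨_, S.finite_toSet.image _, hS⟩
  have hclosed : ∀ j, IsClosed (Γ.pieces j) := fun j => by
    obtain ⟨S, hS, hj⟩ := hfin j
    rw [hj]
    exact (hS.isCompact_convexHull ℝ).isClosed
  have hfar : ∀ᶠ ε in nhds (0 : ℝ), ∀ j, p ∉ Γ.pieces j → p + ε • u ∉ Γ.pieces j := by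
    rw [Filter.eventually_all]
    intro j
    by_cases hj : p ∈ Γ.pieces j
    · simp [hj]
    have hcont : Continuous fun ε : ℝ => p + ε • u := by fun_prop
    have := hcont.continuousAt (x := 0) |>.preimage_mem_nhds
      (t := (Γ.pieces j)ᶜ) ((hclosed j).isOpen_compl.mem_nhds (by simpa using hj))
    filter_upwards [this] with ε hε _ using hε
  obtain ⟨ε, ⟨hετ, hεfar⟩, hε⟩ :=
    ((((eventually_add_smul_mem_of_mem_intrinsicInterior hpin hu).and hfar).filter_mono
      nhdsWithin_le_nhds).and (self_mem_nhdsWithin (s := Ioi (0 : ℝ)))).exists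
  have hε0 : (0 : ℝ) < ε := hε
  have hyΔ : p + ε • u ∈ ⋃ j, Γ.pieces j := Γ.covers.superset (hτ.subset hετ)
  obtain ⟨j, hyj⟩ := mem_iUnion.1 hyΔ
  have hpj : p ∈ Γ.pieces j := by
    by_contra h
    exact hεfar j h hyj
  obtain ⟨hvert, e, b, -, he, hall, hspan⟩ := hns.2.2 p hp j hpj
  obtain ⟨S, hS, hSj⟩ := hfin j
  have hcone := sub_mem_span_edges hS hSj hvert hyj
  rw [add_sub_cancel_left] at hcone
  have hle : Submodule.span NNReal {g | ∃ e, IsEdgeOf e (Γ.pieces j) ∧ p ∈ e ∧ p + g ∈ e} ≤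
      Submodule.span NNReal (Set.range fun a => castVec (b a)) := by
    rw [Submodule.span_le]
    rintro g ⟨e', he', hpe', hge'⟩
    obtain ⟨a, rfl⟩ := hall e' he' hpe'
    obtain ⟨hb0, ⟨t, ht, hte⟩, -⟩ := (he a).2.2
    obtain ⟨r, hr, rfl⟩ := hvert.exists_smul_of_edge he'.1.subset he'.2 hpe'
      (castVec_ne_zero hb0) ht hte hge'
    exact Submodule.smul_mem _ (⟨r, hr⟩ : NNReal) (Submodule.subset_span ⟨a, rfl⟩)
  obtain ⟨c, hc⟩ := (Submodule.mem_span_range_iff_exists_fun NNReal).1 (hle hcone)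
  have hc' : ∑ a, (c a : ℝ) • castVec (b a) = ε • u := hc
  refine ⟨j, e, b, fun a => ε⁻¹ * c a, hvert, he, hspan, fun a => by positivity, ?_, ?_⟩
  · simp only [mul_smul]
    rw [← Finset.smul_sum, hc', smul_smul, inv_mul_cancel₀ hε0.ne', one_smul]
  intro a ha
  have hca : (0 : ℝ) < c a := lt_of_le_of_ne (c a).2 (right_ne_zero_of_mul ha).symm
  have hjΔ : Γ.pieces j ⊆ Δ := (subset_iUnion _ j).trans Γ.covers.subset
  have hea := (he a).1
  have heτ : e a ⊆ τ := by
    rcases hτ with rfl | ⟨f, d, hfd, rfl, -⟩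
    · exact hea.1.subset.trans hjΔ
    have hfb : ∀ k, f (castVec (b k)) ≤ 0 := fun k => by
      obtain ⟨-, ⟨t, ht, hte⟩, -⟩ := (he k).2.2
      have := hfd _ (hjΔ ((he k).1.1.subset hte))
      rw [map_add, map_smul, hpτ.2, smul_eq_mul] at this
      exact nonpos_of_mul_nonpos_right (by linarith) ht
    have hfu : ∑ k, (c k : ℝ) * f (castVec (b k)) = 0 := by
      have h1 := congrArg f hc'
      have h2 := hετ.2
      rw [map_add, hpτ.2] at h2
      rw [map_sum] at h1
      simp only [map_smul f (_ : ℝ) (castVec _), smul_eq_mul] at h1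
      linarith
    have hfa : f (castVec (b a)) = 0 := by
      have := (Finset.sum_eq_zero_iff_of_nonpos fun k _ =>
        mul_nonpos_of_nonneg_of_nonpos (c k).2 (hfb k)).1 hfu a (Finset.mem_univ a)
      exact (mul_eq_zero.1 this).resolve_left hca.ne'
    intro x hx
    obtain ⟨hb0, ⟨t, ht, hte⟩, -⟩ := (he a).2.2
    obtain ⟨r, -, hr⟩ := hvert.exists_smul_of_edge (g := x - p) hea.1.subset hea.2 (he a).2.1
      (castVec_ne_zero hb0) ht hte
      (by rwa [add_sub_cancel])
    refine ⟨hjΔ (hea.1.subset hx), ?_⟩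
    have := congrArg f hr
    rw [map_sub, map_smul, hfa, smul_zero, hpτ.2] at this
    linarith
  refine ⟨j, ?_, hea.2⟩
  rcases hea.1 with h | ⟨f, d, hfd, hfe, hne⟩
  · exact Or.inl (Subset.antisymm (subset_inter hea.1.subset heτ) (h ▸ inter_subset_left))
  · refine Or.inr ⟨f, d, fun x hx => hfd x hx.1, Subset.antisymm (fun x hx => ?_) ?_, hne⟩
    · exact ⟨⟨hea.1.subset hx, heτ hx⟩, (hfe ▸ hx : x ∈ {x ∈ Γ.pieces j | f x = d}).2⟩
    · rintro x ⟨⟨hx, -⟩, hfx⟩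
      exact hfe ▸ ⟨hx, hfx⟩

/-- for a non-singular semi-stable simplicial partition `Γ` of a simplicial
integral polytope `Δ`, at a vertex `p` of `Γ` lying in the relative interior of an
`l`-dimensional face `τ` of `Δ`, the primitive vectors of the `l + 1` edges of `Γ ∩ τ`
at `p` sum to zero. -/
theorem primitive_vectors_sum_zero {n N : ℕ} (hn : 1 ≤ n) {Δ : Set (Fin n → ℝ)}
    (hΔint : IsIntegralPolytope Δ) (hΔdim : polyDim Δ = n) (hΔsimp : IsSimplicial n Δ)
    (Γ : SimplicialPartition n n N Δ) (hss : IsSemiStable Γ)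
    (hns : IsNonsingularPartition Γ)
    (p : Fin n → ℝ) (hp : IsGammaVertex Γ p)
    (l : ℕ) (τ : Set (Fin n → ℝ)) (hτ : IsFaceOf τ Δ) (hτdim : polyDim τ = l)
    (hpin : p ∈ intrinsicInterior ℝ τ)
    (σ : Fin (l + 1) → Set (Fin n → ℝ)) (hσinj : Function.Injective σ)
    (hσ : ∀ i, IsRestrictedEdge Γ τ (σ i) ∧ p ∈ σ i)
    (hall : ∀ e, IsRestrictedEdge Γ τ e → p ∈ e → ∃ i, e = σ i)
    (v : Fin (l + 1) → Fin n → ℤ) (hv : ∀ i, IsPrimitiveEdgeVector (σ i) p (v i)) :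
    (∑ i, v i) = 0 := by
  have hpτ : p ∈ τ := intrinsicInterior_subset hpin
  have hbv : ∀ (j : Fin N) (e : Set (Fin n → ℝ)) (b : Fin n → ℤ) (i : Fin (l + 1)),
      IsVertexOf p (Γ.pieces j) → IsEdgeOf e (Γ.pieces j) → p ∈ e →
      IsPrimitiveEdgeVector e p b → e = σ i → b = v i :=
    fun j e b i hvert he hpe hb hei =>
      hb.unique hvert he.1.subset he.2 hpe (hei ▸ hv i)
  apply sum_eq_zero_of_neg_combinations
  · refine hτdim.symm.le.trans (Submodule.finrank_mono fun u hu => ?_)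
    obtain ⟨j, e, b, c, hvert, he, -, -, rfl, hre⟩ :=
      exists_nonneg_combination Γ hns hp hτ hpin hu
    refine Submodule.sum_mem _ fun a _ => ?_
    by_cases ha : c a = 0
    · simp [ha]
    obtain ⟨i, hi⟩ := hall (e a) (hre a ha) (he a).2.1
    rw [hbv j (e a) (b a) i hvert (he a).1 (he a).2.1 (he a).2.2 hi]
    exact Submodule.smul_mem _ _ (Submodule.subset_span ⟨i, rfl⟩)
  intro i
  have hvT : castVec (v i) ∈ vectorSpan ℝ τ := by
    obtain ⟨-, ⟨t, ht, hte⟩, -⟩ := hv i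
    obtain ⟨⟨j, hj, -⟩, -⟩ := hσ i
    have h1 : t • castVec (v i) ∈ vectorSpan ℝ τ := by
      simpa using vsub_mem_vectorSpan ℝ (hj.subset hte).2 hpτ
    simpa [smul_smul, inv_mul_cancel₀ ht.ne'] using Submodule.smul_mem _ t⁻¹ h1
  obtain ⟨j, e, b, c, hvert, he, hspan, hc0, hc, hre⟩ :=
    exists_nonneg_combination Γ hns hp hτ hpin (Submodule.neg_mem _ hvT)
  have hli := linearIndependent_castVec hspan
  obtain ⟨m, hm⟩ := (Submodule.mem_span_range_iff_exists_fun ℤ).1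
    (hspan ▸ trivial : -v i ∈ Submodule.span ℤ (Set.range b))
  have hneg : castVec (-v i) = -castVec (v i) := (castVecHom n).map_neg _
  have hmc : ∀ a, c a = m a := by
    have h1 : ∑ a, c a • castVec (b a) = ∑ a, (m a : ℝ) • castVec (b a) := by
      rw [← hc, ← castVec_sum_smul, hm, hneg]
    exact Fintype.linearIndependent_iffₛ.1 hli _ _ h1
  have hm0 : ∀ a, 0 ≤ m a := fun a => by exact_mod_cast hmc a ▸ hc0 a
  have hidx : ∀ a, m a ≠ 0 → ∃ k, e a = σ k := fun a ha =>
    hall (e a) (hre a (by rw [hmc]; exact_mod_cast ha)) (he a).2.1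
  have hmi : ∀ a, e a = σ i → m a = 0 := fun a ha => by
    have hba := hbv j (e a) (b a) i hvert (he a).1 (he a).2.1 (he a).2.2 ha
    have h1 : ∑ k, (m k : ℝ) • castVec (b k) =
        ∑ k, (Pi.single a (-1) : Fin n → ℝ) k • castVec (b k) := by
      rw [← castVec_sum_smul, hm, hneg, ← hba]
      simp [Pi.single_apply]
    have h2 := Fintype.linearIndependent_iffₛ.1 hli _ _ h1 a
    have h3 : m a = -1 := by
      simp only [Pi.single_eq_same] at h2
      exact_mod_cast h2
    have := hm0 a
    omega
  classical
  refine ⟨fun k => (∑ a, if e a = σ k then m a else 0) + if k = i then 1 else 0,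
    fun k => add_nonneg (Finset.sum_nonneg fun a _ => ?_) (by split_ifs <;> simp), ?_, ?_⟩
  · split_ifs
    exacts [hm0 a, le_rfl]
  · simp only [if_true]
    rw [Finset.sum_eq_zero fun a _ => ?_, zero_add]
    split_ifs with h
    exacts [hmi a h, rfl]
  · simp only [add_smul, Finset.sum_smul, Finset.sum_add_distrib, ite_smul, one_smul, zero_smul]
    rw [Finset.sum_comm]
    have : ∀ a, (∑ k, if e a = σ k then m a • v k else 0) = m a • b a := fun a => by
      by_cases ha : m a = 0
      · simp [ha]
      obtain ⟨k, hk⟩ := hidx a ha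
      rw [Finset.sum_eq_single k (fun k' _ hk' => if_neg fun h => hk' (hσinj (h.symm.trans hk)))
        (by simp), if_pos hk,
        hbv j (e a) (b a) k hvert (he a).1 (he a).2.1 (he a).2.2 hk]
    simp only [this, hm, Finset.sum_ite_eq', Finset.mem_univ, if_true, neg_add_cancel]
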